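/- arXiv:1903.05494 — 3 statements merged into one kernel-verified Lean document; each statement's English description precedes it below -/
import Mathlib

section
/- Let C = [C_1, C_2, ..., C_s]A be a matrix-product code where A ∈ F_q^{s×s} is an invertible square matrix. Then the dual code satisfies C^⊥ = [C_1^⊥, C_2^⊥, ..., C_s^⊥](A^{-1})^T. -/
open Matrix
open scoped Pointwise

/-- The matrix-product code `[C_1, …, C_s]A`, a subspace of `F^{l·n}`: the codeword
corresponding to `(c_1,…,c_s)` has `(j,k)` entry `∑ i, A i j * (c i) k`. -/
noncomputable def matrixProdCode {F : Type*} [Field F] {n s l : ℕ}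
    (C : Fin s → Submodule F (Fin n → F)) (A : Matrix (Fin s) (Fin l) F) :
    Submodule F (Fin l × Fin n → F) :=
  Submodule.map
    (show (Fin s → Fin n → F) →ₗ[F] (Fin l × Fin n → F) from
      { toFun := fun c (jk : Fin l × Fin n) => ∑ i, A i jk.1 * c i jk.2
        map_add' := by
          intro a b; funext jk
          simp [mul_add, Finset.sum_add_distrib]
        map_smul' := by
          intro r a; funext jk
          simp [Finset.mul_sum, mul_left_comm] })
    (Submodule.pi Set.univ C)

/-- Dual code w.r.t. the standard inner product. -/
def dualCode {F : Type*} [Field F] {ι : Type*} [Fintype ι] (C : Submodule F (ι → F)) :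
    Submodule F (ι → F) where
  carrier := {x | ∀ c ∈ C, ∑ i, x i * c i = 0}
  zero_mem' := by intro c hc; simp
  add_mem' := by
    intro a b ha hb c hc
    simp only [Pi.add_apply, add_mul, Finset.sum_add_distrib, ha c hc, hb c hc, add_zero]
  smul_mem' := by
    intro r x hx c hc
    simp only [Pi.smul_apply, smul_eq_mul, mul_assoc, ← Finset.mul_sum, hx c hc, mul_zero]

section

variable {F : Type*} [Field F] {n s l : ℕ}

theorem mem_matrixProdCode {C : Fin s → Submodule F (Fin n → F)} {A : Matrix (Fin s) (Fin l) F}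
    {x : Fin l × Fin n → F} :
    x ∈ matrixProdCode C A ↔
      ∃ c : Matrix (Fin s) (Fin n) F,
        (∀ i, c i ∈ C i) ∧ Aᵀ * c = Matrix.of fun j k => x (j, k) := by
  simp only [matrixProdCode, Submodule.mem_map, Submodule.mem_pi, Set.mem_univ, true_implies]
  refine exists_congr fun c => and_congr_right fun _ => ?_
  constructor
  · rintro rfl
    ext j k
    exact Matrix.mul_apply
  · intro h
    ext ⟨j, k⟩
    exact Matrix.mul_apply.symm.trans (congrFun (congrFun h j) k)

theorem mem_matrixProdCode_inv_transpose {C : Fin s → Submodule F (Fin n → F)}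
    {A : Matrix (Fin s) (Fin s) F} (hA : IsUnit A) {x : Fin s × Fin n → F} :
    x ∈ matrixProdCode C A⁻¹ᵀ ↔ ∀ i, (A * Matrix.of fun j k => x (j, k)) i ∈ C i := by
  have hdet := (Matrix.isUnit_iff_isUnit_det A).mp hA
  rw [mem_matrixProdCode, Matrix.transpose_transpose]
  constructor
  · rintro ⟨c, hc, h⟩
    rwa [← h, Matrix.mul_nonsing_inv_cancel_left _ _ hdet]
  · intro h
    exact ⟨_, h, Matrix.nonsing_inv_mul_cancel_left _ _ hdet⟩

theorem sum_mul_transpose_mul (A : Matrix (Fin s) (Fin l) F) (c : Matrix (Fin s) (Fin n) F)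
    (x : Fin l × Fin n → F) :
    ∑ p : Fin l × Fin n, x p * (Aᵀ * c) p.1 p.2 =
      ∑ i, ∑ k, (A * Matrix.of fun j k => x (j, k)) i k * c i k := by
  simp only [Fintype.sum_prod_type, Matrix.mul_apply, Matrix.transpose_apply, Matrix.of_apply,
    Finset.mul_sum, Finset.sum_mul]
  rw [Finset.sum_comm, Finset.sum_comm (s := Finset.univ (α := Fin s))]
  refine Finset.sum_congr rfl fun k _ => ?_
  rw [Finset.sum_comm]
  exact Finset.sum_congr rfl fun i _ => Finset.sum_congr rfl fun j _ => by ring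

theorem mem_dualCode_matrixProdCode {C : Fin s → Submodule F (Fin n → F)}
    {A : Matrix (Fin s) (Fin l) F} {x : Fin l × Fin n → F} :
    x ∈ dualCode (matrixProdCode C A) ↔
      ∀ i, (A * Matrix.of fun j k => x (j, k)) i ∈ dualCode (C i) := by
  constructor
  · intro h i c hc
    have hsum := h (fun p => (Aᵀ * Matrix.of (Pi.single i c)) p.1 p.2) <|
      mem_matrixProdCode.mpr ⟨Matrix.of (Pi.single i c), fun i' => by
        change (Pi.single i c : Fin s → Fin n → F) i' ∈ C i'
        obtain rfl | hi := eq_or_ne i' i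
        · simpa using hc
        · simp [hi], rfl⟩
    rw [sum_mul_transpose_mul, Finset.sum_eq_single i] at hsum
    · simpa using hsum
    · intro i' _ hi
      simp [hi]
    · simp
  · intro h y hy
    obtain ⟨c, hc, hcy⟩ := mem_matrixProdCode.mp hy
    obtain rfl : y = fun p => (Aᵀ * c) p.1 p.2 := by
      rw [hcy]
      rfl
    rw [sum_mul_transpose_mul]
    exact Finset.sum_eq_zero fun i _ => h i _ (hc i)

end

/-- If `A` is an invertible `s × s` matrix, then the dual of the
matrix-product code `[C_1,…,C_s]A` is `[C_1^⊥,…,C_s^⊥](A⁻¹)ᵀ`. -/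
theorem dual_matrixProdCode
    {F : Type*} [Field F] [Fintype F] {n s : ℕ}
    (C : Fin s → Submodule F (Fin n → F))
    (A : Matrix (Fin s) (Fin s) F) (hA : IsUnit A) :
    dualCode (matrixProdCode C A) = matrixProdCode (fun i => dualCode (C i)) A⁻¹ᵀ := by
  ext x
  rw [mem_dualCode_matrixProdCode, mem_matrixProdCode_inv_transpose hA]
end

section
/- Let C_1, C_2 ⊆ F_q^n be linear codes, let A be the 2×2 matrix with rows (1,1) and (0,1) over F_q, and set C = [C_1, C_2]A. Then the square of C satisfies C^{*2} = [C_1^{*2}, (C_1 + C_2)*C_2]A, and consequently d(C^{*2}) ≥ min{2 d(C_1^{*2}), d((C_1 + C_2)*C_2)}. -/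
open scoped Pointwise

/-- Hamming weight of a vector. -/
noncomputable def wt {ι F : Type*} [Fintype ι] [Zero F] (x : ι → F) : ℕ :=
  letI := Classical.decEq F
  (Finset.univ.filter fun i => x i ≠ 0).card

/-- Minimum distance (= minimum weight) of a code given as a set. -/
noncomputable def minDist {ι F : Type*} [Fintype ι] [Zero F] (C : Set (ι → F)) : ℕ :=
  sInf (wt '' {x ∈ C | x ≠ 0})

/-- Componentwise (Schur) product of two codes. -/
def schurProd {F : Type*} [Field F] {ι : Type*} (C C' : Submodule F (ι → F)) :
    Submodule F (ι → F) :=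
  Submodule.span F {x | ∃ c ∈ C, ∃ c' ∈ C', x = c * c'}

theorem mem_matrixProdCode_uuv {F : Type*} [Field F] {n : ℕ} (A B : Submodule F (Fin n → F))
    (x : Fin 2 × Fin n → F) :
    x ∈ matrixProdCode ![A, B] !![(1 : F), 1; 0, 1] ↔
      (fun k => x (0, k)) ∈ A ∧ (fun k => x (1, k) - x (0, k)) ∈ B := by
  unfold matrixProdCode
  rw [Submodule.mem_map]
  constructor
  · rintro ⟨c, hc, rfl⟩
    have h0 : c 0 ∈ A := hc 0 trivial
    have h1 : c 1 ∈ B := hc 1 trivial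
    constructor
    · convert h0 using 1
      funext k
      simp [Fin.sum_univ_two]
    · convert h1 using 1
      funext k
      simp [Fin.sum_univ_two]
  · rintro ⟨h0, h1⟩
    refine ⟨![fun k => x (0, k), fun k => x (1, k) - x (0, k)], ?_, ?_⟩
    · intro i _
      fin_cases i
      · exact h0
      · exact h1
    · funext ⟨j, k⟩
      fin_cases j <;> simp [Fin.sum_univ_two]

theorem mul_mem_schurProd {F ι : Type*} [Field F] {C C' : Submodule F (ι → F)} {c c' : ι → F}
    (hc : c ∈ C) (hc' : c' ∈ C') : c * c' ∈ schurProd C C' :=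
  Submodule.subset_span ⟨c, hc, c', hc', rfl⟩

theorem schurProd_le {F ι : Type*} [Field F] {C C' D : Submodule F (ι → F)}
    (h : ∀ c ∈ C, ∀ c' ∈ C', c * c' ∈ D) : schurProd C C' ≤ D := by
  refine Submodule.span_le.2 ?_
  rintro _ ⟨c, hc, c', hc', rfl⟩
  exact h c hc c' hc'

theorem schurProd_uuv {F : Type*} [Field F] {n : ℕ} (C₁ C₂ : Submodule F (Fin n → F)) :
    schurProd (matrixProdCode ![C₁, C₂] !![(1 : F), 1; 0, 1])
        (matrixProdCode ![C₁, C₂] !![(1 : F), 1; 0, 1]) =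
      matrixProdCode ![schurProd C₁ C₁, schurProd (C₁ ⊔ C₂) C₂] !![(1 : F), 1; 0, 1] := by
  apply le_antisymm
  · refine schurProd_le fun c hc c' hc' => ?_
    rw [mem_matrixProdCode_uuv] at hc hc' ⊢
    refine ⟨mul_mem_schurProd hc.1 hc'.1, ?_⟩
    have h : (fun k => c (1, k)) ∈ C₁ ⊔ C₂ := by
      convert Submodule.add_mem_sup hc.1 hc.2 using 1
      funext k
      simp
    convert add_mem (mul_mem_schurProd h hc'.2)
      (mul_mem_schurProd (Submodule.mem_sup_left hc'.1 : _ ∈ C₁ ⊔ C₂) hc.2) using 1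
    funext k
    simp only [Pi.mul_apply, Pi.add_apply]
    ring
  · set S := schurProd (matrixProdCode ![C₁, C₂] !![(1 : F), 1; 0, 1])
        (matrixProdCode ![C₁, C₂] !![(1 : F), 1; 0, 1])
    let diag : (Fin n → F) →ₗ[F] (Fin 2 × Fin n → F) :=
      LinearMap.funLeft F F Prod.snd
    let snd : (Fin n → F) →ₗ[F] (Fin 2 × Fin n → F) :=
      { toFun := fun a jk => if jk.1 = 0 then 0 else a jk.2
        map_add' := by
          intro a b
          funext jk
          by_cases h : jk.1 = 0 <;> simp [h]
        map_smul' := by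
          intro r a
          funext jk
          by_cases h : jk.1 = 0 <;> simp [h] }
    have hdiag : ∀ c ∈ C₁, diag c ∈ matrixProdCode ![C₁, C₂] !![(1 : F), 1; 0, 1] := by
      intro c hc
      rw [mem_matrixProdCode_uuv]
      refine ⟨hc, ?_⟩
      convert C₂.zero_mem using 1
      funext k
      simp [diag, LinearMap.funLeft_apply]
    have hsnd : ∀ c ∈ C₂, snd c ∈ matrixProdCode ![C₁, C₂] !![(1 : F), 1; 0, 1] := by
      intro c hc
      rw [mem_matrixProdCode_uuv]
      constructor
      · convert C₁.zero_mem using 1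
        funext k
        simp [snd]
      · convert hc using 1
        funext k
        simp [snd]
    have h₁ : schurProd C₁ C₁ ≤ S.comap diag :=
      schurProd_le fun c hc c' hc' => mul_mem_schurProd (hdiag c hc) (hdiag c' hc')
    have h₂ : schurProd (C₁ ⊔ C₂) C₂ ≤ S.comap snd := by
      refine schurProd_le fun c hc c' hc' => ?_
      obtain ⟨a, ha, b, hb, rfl⟩ := Submodule.mem_sup.1 hc
      rw [Submodule.mem_comap]
      convert add_mem (mul_mem_schurProd (hdiag a ha) (hsnd c' hc'))
        (mul_mem_schurProd (hsnd b hb) (hsnd c' hc')) using 1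
      funext jk
      by_cases h : jk.1 = 0 <;> simp [snd, diag, h, add_mul]
    intro x hx
    rw [mem_matrixProdCode_uuv] at hx
    convert add_mem (Submodule.mem_comap.1 (h₁ hx.1)) (Submodule.mem_comap.1 (h₂ hx.2)) using 1
    funext ⟨j, k⟩
    fin_cases j <;> simp [snd, diag]

theorem minDist_le_wt {ι F : Type*} [Fintype ι] [Zero F] {C : Set (ι → F)} {x : ι → F}
    (hx : x ∈ C) (h0 : x ≠ 0) : minDist C ≤ wt x :=
  Nat.sInf_le ⟨x, ⟨hx, h0⟩, rfl⟩

theorem wt_fin_two_prod {F : Type*} [Zero F] {n : ℕ} (x : Fin 2 × Fin n → F) :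
    wt x = wt (fun k => x (0, k)) + wt (fun k => x (1, k)) := by
  classical
  simp only [wt, Finset.card_filter, Fintype.sum_prod_type, Fin.sum_univ_two]

theorem wt_sub_le {ι F : Type*} [Fintype ι] [AddGroup F] (x y : ι → F) :
    wt (fun i => x i - y i) ≤ wt y + wt x := by
  classical
  simp only [wt]
  refine le_trans (Finset.card_le_card ?_) (Finset.card_union_le _ _)
  intro i
  simp only [Finset.mem_filter, Finset.mem_union, Finset.mem_univ, true_and]
  contrapose!
  rintro ⟨hy, hx⟩
  simp [hx, hy]

theorem min_le_minDist_uuv {F : Type*} [Field F] {n : ℕ} (A B : Submodule F (Fin n → F)) :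
    min (2 * minDist (A : Set (Fin n → F))) (minDist (B : Set (Fin n → F))) ≤
      minDist (matrixProdCode ![A, B] !![(1 : F), 1; 0, 1] : Set (Fin 2 × Fin n → F)) := by
  set P := matrixProdCode ![A, B] !![(1 : F), 1; 0, 1]
  rcases Set.eq_empty_or_nonempty
      (wt '' {x ∈ (P : Set (Fin 2 × Fin n → F)) | x ≠ 0}) with he | hne
  · suffices minDist (A : Set (Fin n → F)) = 0 by simp [this]
    have hA : {a ∈ (A : Set (Fin n → F)) | a ≠ 0} = ∅ := by
      refine Set.eq_empty_iff_forall_notMem.2 fun a ha => ?_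
      refine Set.eq_empty_iff_forall_notMem.1 (Set.image_eq_empty.1 he) (fun jk => a jk.2)
        ⟨?_, fun h => ha.2 (funext fun k => congrFun h (0, k))⟩
      refine (mem_matrixProdCode_uuv A B _).2 ⟨ha.1, ?_⟩
      convert B.zero_mem using 1
      funext k
      simp
    rw [minDist, hA, Set.image_empty, Nat.sInf_empty]
  · obtain ⟨x, ⟨hxP, hx0⟩, hx⟩ := Nat.sInf_mem hne
    obtain ⟨hA, hB⟩ := (mem_matrixProdCode_uuv A B x).1 hxP
    change _ ≤ sInf _
    rw [← hx, wt_fin_two_prod]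
    by_cases hd : (fun k => x (1, k) - x (0, k)) = 0
    · have hd' : (fun k => x (1, k)) = fun k => x (0, k) :=
        funext fun k => sub_eq_zero.1 (congrFun hd k)
      have h0 : (fun k => x (0, k)) ≠ 0 := by
        intro h
        refine hx0 (funext fun ⟨j, k⟩ => ?_)
        fin_cases j
        · exact congrFun h k
        · exact congrFun (hd'.trans h) k
      rw [hd', ← two_mul]
      exact (min_le_left _ _).trans (Nat.mul_le_mul_left 2 (minDist_le_wt hA h0))
    · exact (min_le_right _ _).trans ((minDist_le_wt hB hd).trans (wt_sub_le _ _))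

/-- For `C = [C_1, C_2]A` with `A = [[1,1],[0,1]]` one has
`C^{*2} = [C_1^{*2}, (C_1 + C_2) * C_2]A`, and consequently
`d(C^{*2}) ≥ min{2 d(C_1^{*2}), d((C_1 + C_2) * C_2)}`. -/
theorem uuv_square
    {F : Type*} [Field F] [Fintype F] {n : ℕ} (C₁ C₂ : Submodule F (Fin n → F)) :
    schurProd (matrixProdCode ![C₁, C₂] !![(1 : F), 1; 0, 1])
        (matrixProdCode ![C₁, C₂] !![(1 : F), 1; 0, 1]) =
      matrixProdCode ![schurProd C₁ C₁, schurProd (C₁ ⊔ C₂) C₂] !![(1 : F), 1; 0, 1] ∧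
    min (2 * minDist (schurProd C₁ C₁ : Set (Fin n → F)))
        (minDist (schurProd (C₁ ⊔ C₂) C₂ : Set (Fin n → F))) ≤
      minDist (schurProd (matrixProdCode ![C₁, C₂] !![(1 : F), 1; 0, 1])
          (matrixProdCode ![C₁, C₂] !![(1 : F), 1; 0, 1]) : Set (Fin 2 × Fin n → F)) := by
  rw [schurProd_uuv]
  exact ⟨rfl, min_le_minDist_uuv _ _⟩
end

section
/- Let gcd(n,q) = 1, let I_1, I_2 be unions of q-cyclotomic cosets modulo n, and let C = [C(I_1), C(I_2)]A be the (u,u+v)-construction with constituent cyclic codes C(I_1), C(I_2) (A having rows (1,1),(0,1)). Then dim(C^{*2}) = |I_1 + I_1| + |I_2 + (I_1 ∪ I_2)| and d(C^{*2}) ≥ min{2(n − Amp(I_1 + I_1) + 1), n − Amp(I_2 + (I_1 ∪ I_2)) + 1}. -/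
open scoped Pointwise

/-- The cyclic code `C(I)` of length `n` over `F` with generating set `I` (where
`β` is a primitive `n`-th root of unity in the algebraic closure of `F`):
codewords are the coefficient vectors `c` whose polynomial `∑ c_k x^k` vanishes at
`β^j` for every `j` outside `I`; equivalently, the code generated by
`g = (x^n-1)/∏_{i∈I}(x-β^i)`. -/
noncomputable def cyclicCode (F : Type*) [Field F] (n : ℕ) [NeZero n]
    (β : AlgebraicClosure F) (I : Set (ZMod n)) : Submodule F (Fin n → F) where
  carrier := {c | ∀ j : ZMod n, j ∉ I →
    ∑ k : Fin n, algebraMap F (AlgebraicClosure F) (c k) * β ^ (j * (k : ZMod n)).val = 0}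
  zero_mem' := by intro j hj; simp
  add_mem' := by
    intro a b ha hb j hj
    simp only [Pi.add_apply, map_add, add_mul, Finset.sum_add_distrib, ha j hj, hb j hj,
      add_zero]
  smul_mem' := by
    intro r c hc j hj
    simp only [Pi.smul_apply, smul_eq_mul, map_mul, mul_assoc, ← Finset.mul_sum, hc j hj,
      mul_zero]

/-- The amplitude of a subset of `ℤ/nℤ`: the least length of a cyclic interval
`{c, c+1, …, c+i-1}` containing it. -/
noncomputable def amp {n : ℕ} (I : Set (ZMod n)) : ℕ :=
  sInf {i : ℕ | ∃ c : ZMod n, I ⊆ {x | ∃ t : ℕ, t < i ∧ x = c + (t : ZMod n)}}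

theorem wt_eq_sum {ι R : Type*} [Fintype ι] [Zero R] [DecidableEq R] (x : ι → R) :
    wt x = ∑ i, if x i ≠ 0 then 1 else 0 := by
  rw [wt, Finset.card_filter]
  congr!

section ExtendScalars

variable {F : Type*} (K : Type*) [Field F] [Field K] [Algebra F K] {ι : Type*}

/-- The `K`-span of a code over the subfield `F`. -/
noncomputable def extendScalars (W : Submodule F (ι → F)) : Submodule K (ι → K) :=
  Submodule.span K ((Algebra.linearMap F K).compLeft ι '' (W : Set (ι → F)))

theorem extendScalars_span (s : Set (ι → F)) :
    extendScalars K (Submodule.span F s) =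
      Submodule.span K ((Algebra.linearMap F K).compLeft ι '' s) := by
  rw [extendScalars, ← Submodule.map_coe, Submodule.map_span, Submodule.span_span_of_tower]

theorem extendScalars_sup (W W' : Submodule F (ι → F)) :
    extendScalars K (W ⊔ W') = extendScalars K W ⊔ extendScalars K W' := by
  conv_lhs => rw [← Submodule.span_eq W, ← Submodule.span_eq W', ← Submodule.span_union]
  rw [extendScalars_span, Set.image_union, Submodule.span_union]
  rfl

theorem schurProd_eq_mul (C C' : Submodule F (ι → F)) : schurProd C C' = C * C' := by
  rw [Submodule.mul_eq_span_mul_set, schurProd]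
  congr 1
  ext x
  simp only [Set.mem_ofPred_eq, Set.mem_mul, SetLike.mem_coe, eq_comm]

theorem extendScalars_schurProd (W W' : Submodule F (ι → F)) :
    extendScalars K (schurProd W W') = extendScalars K W * extendScalars K W' := by
  rw [schurProd_eq_mul, Submodule.mul_eq_span_mul_set, extendScalars_span, extendScalars,
    extendScalars, Submodule.span_mul_span]
  congr 1
  refine Set.image_image2_distrib fun a b => ?_
  ext k
  simp

theorem LinearIndependent.extendScalars {κ : Type*} {w : κ → ι → F}
    (hw : LinearIndependent F w) :
    LinearIndependent K fun i => (Algebra.linearMap F K).compLeft ι (w i) := by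
  rw [linearIndependent_iff'] at hw ⊢
  intro s g hg i hi
  rw [← Module.forall_dual_apply_eq_zero_iff F]
  intro φ
  refine hw s (fun i => φ (g i)) ?_ i hi
  ext k
  have h := congrArg φ (congrFun hg k)
  simp only [Finset.sum_apply, Pi.smul_apply, LinearMap.compLeft_apply, Function.comp_apply,
    Algebra.linearMap_apply, smul_eq_mul, map_sum, Pi.zero_apply, map_zero] at h ⊢
  rw [← h]
  refine Finset.sum_congr rfl fun i _ => ?_
  rw [mul_comm (g i), ← Algebra.smul_def, map_smul, smul_eq_mul, mul_comm]

theorem finrank_extendScalars [Finite ι] (W : Submodule F (ι → F)) :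
    Module.finrank K (extendScalars K W) = Module.finrank F W := by
  let b := Module.finBasis F W
  have hb : LinearIndependent F fun i => (b i : ι → F) :=
    b.linearIndependent.map' W.subtype W.ker_subtype
  have hW : W = Submodule.span F (Set.range fun i => (b i : ι → F)) := by
    rw [Set.range_comp' Subtype.val b, ← W.coe_subtype, ← Submodule.map_span, b.span_eq,
      Submodule.map_subtype_top]
  conv_lhs => rw [hW]
  rw [extendScalars_span, ← Set.range_comp]
  exact (finrank_span_eq_card (hb.extendScalars K)).trans (Fintype.card_fin _)

end ExtendScalars

theorem FiniteField.exists_algebraMap_eq_of_pow_card {F K : Type*} [Field F] [Fintype F]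
    [Field K] [Algebra F K] {x : K} (h : x ^ Fintype.card F = x) :
    ∃ y, algebraMap F K y = x := by
  have hs : (Polynomial.X ^ Fintype.card F - Polynomial.X : Polynomial F).Splits := by
    rw [Polynomial.splits_iff_card_roots, FiniteField.roots_X_pow_card_sub_X F,
      FiniteField.X_pow_card_sub_X_natDegree_eq F Fintype.one_lt_card]
    rfl
  exact hs.mem_range_of_isRoot
    (FiniteField.X_pow_card_sub_X_ne_zero F Fintype.one_lt_card) (by simp [h])

section Characters

variable {K : Type*} [Field K] {n : ℕ} [NeZero n]

theorem sum_fin_natCast_zmod {M : Type*} [AddCommMonoid M] (f : ZMod n → M) :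
    ∑ k : Fin n, f ((k : ℕ) : ZMod n) = ∑ a, f a := by
  refine Fintype.sum_bijective (fun k : Fin n => ((k : ℕ) : ZMod n)) ?_ _ _ fun _ => rfl
  rw [Fintype.bijective_iff_injective_and_card]
  refine ⟨fun a b h => ?_, by simp⟩
  have h' := congrArg ZMod.val h
  simp only [ZMod.val_natCast, Nat.mod_eq_of_lt (Fin.is_lt _)] at h'
  exact Fin.ext h'

/-- The vector of values of the character `x ↦ ψ (-(j * x))`. -/
def charVec (ψ : AddChar (ZMod n) K) (j : ZMod n) (k : Fin n) : K :=
  ψ (-(j * ((k : ℕ) : ZMod n)))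

omit [NeZero n] in
theorem charVec_add (ψ : AddChar (ZMod n) K) (i j : ZMod n) :
    charVec ψ (i + j) = charVec ψ i * charVec ψ j := by
  ext k
  simp only [charVec, Pi.mul_apply, ← AddChar.map_add_eq_mul]
  congr 1
  ring

theorem sum_charVec_mul {ψ : AddChar (ZMod n) K} (hψ : ψ.IsPrimitive) (i j : ZMod n) :
    ∑ k : Fin n, charVec ψ i k * ψ (j * ((k : ℕ) : ZMod n)) = if i = j then (n : K) else 0 := by
  have h := AddChar.sum_mulShift (j - i) hψ
  rw [← sum_fin_natCast_zmod] at h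
  simp only [ZMod.card, sub_eq_zero, Nat.cast_ite, Nat.cast_zero] at h
  simp only [charVec, ← AddChar.map_add_eq_mul, eq_comm (a := i)]
  rw [← h]
  refine Finset.sum_congr rfl fun k _ => ?_
  congr 1
  ring

theorem linearIndependent_charVec {ψ : AddChar (ZMod n) K} (hψ : ψ.IsPrimitive)
    (hn : (n : K) ≠ 0) : LinearIndependent K (charVec ψ) := by
  rw [Fintype.linearIndependent_iff]
  intro g hg j
  have h : ∑ k : Fin n, (∑ i, g i • charVec ψ i) k * ψ (j * ((k : ℕ) : ZMod n)) = 0 := by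
    rw [hg]
    simp
  simp only [Finset.sum_apply, Pi.smul_apply, smul_eq_mul, Finset.sum_mul] at h
  rw [Finset.sum_comm] at h
  simp only [mul_assoc, ← Finset.mul_sum, sum_charVec_mul hψ] at h
  simpa [hn] using h

/-- The span of the character vectors with index in `I`. -/
def charSpan (ψ : AddChar (ZMod n) K) (I : Set (ZMod n)) : Submodule K (Fin n → K) :=
  Submodule.span K (charVec ψ '' I)

theorem finrank_charSpan {ψ : AddChar (ZMod n) K} (hψ : ψ.IsPrimitive)
    (hn : (n : K) ≠ 0) (I : Set (ZMod n)) : Module.finrank K (charSpan ψ I) = I.ncard := by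
  classical
  rw [charSpan, Set.image_eq_range, Set.ncard_eq_toFinset_card', Set.toFinset_card]
  exact finrank_span_eq_card ((linearIndependent_charVec hψ hn).comp _ Subtype.val_injective)

omit [NeZero n] in
theorem charSpan_mul (ψ : AddChar (ZMod n) K) (I J : Set (ZMod n)) :
    charSpan ψ I * charSpan ψ J = charSpan ψ (I + J) := by
  rw [charSpan, charSpan, Submodule.span_mul_span, charSpan]
  congr 1
  exact (Set.image_image2_distrib (charVec_add ψ)).symm

omit [NeZero n] in
theorem charSpan_sup (ψ : AddChar (ZMod n) K) (I J : Set (ZMod n)) :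
    charSpan ψ I ⊔ charSpan ψ J = charSpan ψ (I ∪ J) := by
  rw [charSpan, charSpan, charSpan, Set.image_union, Submodule.span_union]

theorem mem_charSpan_of_forall {ψ : AddChar (ZMod n) K} (hψ : ψ.IsPrimitive)
    (hn : (n : K) ≠ 0) {I : Set (ZMod n)} {x : Fin n → K}
    (hx : ∀ j ∉ I, ∑ k : Fin n, x k * ψ (j * ((k : ℕ) : ZMod n)) = 0) : x ∈ charSpan ψ I := by
  have htop : Submodule.span K (Set.range (charVec ψ)) = ⊤ :=
    (linearIndependent_charVec hψ hn).span_eq_top_of_card_eq_finrank' (by simp)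
  obtain ⟨g, hg⟩ := (Submodule.mem_span_range_iff_exists_fun K).1
    (htop ▸ Submodule.mem_top : x ∈ Submodule.span K (Set.range (charVec ψ)))
  rw [← hg]
  refine Submodule.sum_mem _ fun j _ => ?_
  by_cases hj : j ∈ I
  · exact Submodule.smul_mem _ _ (Submodule.subset_span ⟨j, hj, rfl⟩)
  · have h := hx j hj
    rw [← hg] at h
    simp only [Finset.sum_apply, Pi.smul_apply, smul_eq_mul, Finset.sum_mul] at h
    rw [Finset.sum_comm] at h
    simp only [mul_assoc, ← Finset.mul_sum, sum_charVec_mul hψ] at h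
    have hg0 : g j = 0 := by simpa [hn] using h
    simp [hg0]

omit [NeZero n] in
theorem exists_polynomial_of_mem_charSpan {ψ : AddChar (ZMod n) K} {J : Set (ZMod n)} {i : ℕ}
    {c : ZMod n} (hJ : J ⊆ {x | ∃ t : ℕ, t < i ∧ x = c + (t : ZMod n)}) {x : Fin n → K}
    (hx : x ∈ charSpan ψ J) :
    ∃ P ∈ Polynomial.degreeLT K i,
      ∀ k : Fin n, x k = charVec ψ c k * P.eval (charVec ψ 1 k) := by
  induction hx using Submodule.span_induction with
  | mem y hy =>
    obtain ⟨j, hj, rfl⟩ := hy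
    obtain ⟨t, ht, rfl⟩ := hJ hj
    refine ⟨Polynomial.X ^ t, ?_, fun k => ?_⟩
    · rw [Polynomial.mem_degreeLT, Polynomial.degree_X_pow]
      exact_mod_cast ht
    · rw [charVec_add, Pi.mul_apply, Polynomial.eval_pow, Polynomial.eval_X, charVec, charVec,
        charVec, ← AddChar.map_nsmul_eq_pow]
      congr 2
      simp
  | zero => exact ⟨0, Submodule.zero_mem _, by simp⟩
  | add y z _ _ hy hz =>
    obtain ⟨P, hP, hy⟩ := hy
    obtain ⟨Q, hQ, hz⟩ := hz
    exact ⟨P + Q, Submodule.add_mem _ hP hQ, fun k => by simp [hy, hz, mul_add]⟩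
  | smul a y _ hy =>
    obtain ⟨P, hP, hy⟩ := hy
    exact ⟨a • P, Submodule.smul_mem _ _ hP, fun k => by simp [hy, mul_left_comm]⟩

theorem charVec_one_injective {ψ : AddChar (ZMod n) K} (hψ : ψ.IsPrimitive) :
    Function.Injective (charVec ψ 1) := by
  intro a b h
  have hab : ψ (-(1 * ((a : ℕ) : ZMod n)) + 1 * ((b : ℕ) : ZMod n)) = 1 := by
    rw [AddChar.map_add_eq_mul]
    refine (congrArg (· * _) h).trans ?_
    rw [charVec, ← AddChar.map_add_eq_mul, neg_add_cancel, AddChar.map_zero_eq_one]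
  rw [hψ.zmod_char_eq_one_iff, one_mul, one_mul, neg_add_eq_zero] at hab
  have h' := congrArg ZMod.val hab
  simp only [ZMod.val_natCast, Nat.mod_eq_of_lt (Fin.is_lt _)] at h'
  exact Fin.ext h'

theorem amp_spec (J : Set (ZMod n)) :
    ∃ c : ZMod n, J ⊆ {x | ∃ t : ℕ, t < amp J ∧ x = c + (t : ZMod n)} :=
  Nat.sInf_mem (s := {i : ℕ | ∃ c : ZMod n, J ⊆ {x | ∃ t : ℕ, t < i ∧ x = c + (t : ZMod n)}})
    ⟨n, 0, fun x _ => ⟨x.val, x.val_lt, by simp⟩⟩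

theorem card_zeros_add_wt {ι R : Type*} [Fintype ι] [Zero R] [DecidableEq R] (x : ι → R) :
    (Finset.univ.filter fun i => x i = 0).card + wt x = Fintype.card ι := by
  rw [wt, ← Finset.card_univ, ← Finset.card_filter_add_card_filter_not (s := Finset.univ)
    (fun i => x i = 0)]
  congr!

theorem wt_pos {ι R : Type*} [Fintype ι] [Zero R] {x : ι → R} (hx : x ≠ 0) : 0 < wt x := by
  obtain ⟨i, hi⟩ := Function.ne_iff.1 hx
  exact Finset.card_pos.2 ⟨i, by simpa using hi⟩

/-- The BCH bound. -/
theorem le_wt_of_mem_charSpan {ψ : AddChar (ZMod n) K} (hψ : ψ.IsPrimitive)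
    {J : Set (ZMod n)} {x : Fin n → K} (hx : x ∈ charSpan ψ J) (h0 : x ≠ 0) :
    n - amp J + 1 ≤ wt x := by
  classical
  obtain ⟨c, hc⟩ := amp_spec J
  obtain ⟨P, hP, hPx⟩ := exists_polynomial_of_mem_charSpan hc hx
  have hP0 : P ≠ 0 := by
    rintro rfl
    exact h0 (by ext k; simp [hPx])
  have hdeg : P.natDegree < amp J := by
    rw [Polynomial.mem_degreeLT] at hP
    exact (Polynomial.natDegree_lt_iff_degree_lt hP0).2 hP
  have hz : (Finset.univ.filter fun k => x k = 0).card ≤ P.natDegree := by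
    refine le_trans ?_ P.card_roots'
    refine le_trans ?_ (Multiset.toFinset_card_le _)
    rw [← Finset.card_image_of_injective _ (charVec_one_injective hψ)]
    refine Finset.card_le_card fun y hy => ?_
    obtain ⟨k, hk, rfl⟩ := Finset.mem_image.1 hy
    have hk' := (Finset.mem_filter.1 hk).2
    rw [hPx, mul_eq_zero] at hk'
    rw [Multiset.mem_toFinset, Polynomial.mem_roots hP0]
    exact hk'.resolve_left (ψ.val_isUnit _).ne_zero
  have hsum := card_zeros_add_wt x
  rw [Fintype.card_fin] at hsum
  have := wt_pos h0
  omega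

end Characters

section CyclicCode

variable {F : Type*} [Field F] [Fintype F] {n : ℕ} [NeZero n]

omit [Fintype F] in
theorem mem_cyclicCode_iff {β : AlgebraicClosure F} (hβ : IsPrimitiveRoot β n)
    (I : Set (ZMod n)) (c : Fin n → F) :
    c ∈ cyclicCode F n β I ↔ ∀ j ∉ I, ∑ k : Fin n, algebraMap F (AlgebraicClosure F) (c k) *
      AddChar.zmodChar n hβ.pow_eq_one (j * ((k : ℕ) : ZMod n)) = 0 :=
  Iff.rfl

theorem extendScalars_cyclicCode (hn : Nat.Coprime n (Fintype.card F))
    {β : AlgebraicClosure F} (hβ : IsPrimitiveRoot β n) (hnK : (n : AlgebraicClosure F) ≠ 0)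
    {I : Set (ZMod n)} (hI : ∀ a ∈ I, (Fintype.card F : ZMod n) * a ∈ I) :
    extendScalars (AlgebraicClosure F) (cyclicCode F n β I) =
      charSpan (AddChar.zmodChar n hβ.pow_eq_one) I := by
  classical
  have hψ := AddChar.zmodChar_primitive_of_primitive_root n hβ
  have hmem := mem_cyclicCode_iff hβ I
  set ψ := AddChar.zmodChar n hβ.pow_eq_one
  apply le_antisymm
  · rw [extendScalars, Submodule.span_le]
    rintro _ ⟨c, hc, rfl⟩
    exact mem_charSpan_of_forall hψ hnK ((hmem c).1 hc)
  have hinj : Function.Injective fun a : ZMod n => (Fintype.card F : ZMod n) * a :=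
    ((ZMod.isUnit_iff_coprime _ _).2 hn.symm).mul_right_injective
  have hfix (m k : Fin n) :
      (∑ i ∈ I.toFinset, charVec ψ i k * ψ (i * ((m : ℕ) : ZMod n))) ^ Fintype.card F =
        ∑ i ∈ I.toFinset, charVec ψ i k * ψ (i * ((m : ℕ) : ZMod n)) := by
    have himg : I.toFinset.image (fun a => (Fintype.card F : ZMod n) * a) = I.toFinset := by
      refine Finset.eq_of_subset_of_card_le ?_ (Finset.card_image_of_injective _ hinj).ge
      intro y hy
      obtain ⟨a, ha, rfl⟩ := Finset.mem_image.1 hy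
      exact Set.mem_toFinset.2 (hI a (Set.mem_toFinset.1 ha))
    conv_rhs => rw [← himg, Finset.sum_image hinj.injOn]
    rw [← FiniteField.frobeniusAlgHom_apply F (AlgebraicClosure F), map_sum]
    refine Finset.sum_congr rfl fun i _ => ?_
    rw [FiniteField.frobeniusAlgHom_apply, charVec, charVec, ← AddChar.map_add_eq_mul,
      ← AddChar.map_add_eq_mul, ← AddChar.map_nsmul_eq_pow, nsmul_eq_mul]
    congr 1
    ring
  choose s hs using fun m k => FiniteField.exists_algebraMap_eq_of_pow_card (hfix m k)
  have hsI (m : Fin n) : s m ∈ cyclicCode F n β I := by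
    rw [hmem]
    intro j hj
    simp only [hs, Finset.sum_mul]
    rw [Finset.sum_comm]
    refine Finset.sum_eq_zero fun i hi => ?_
    have hij : i ≠ j := fun h => hj (h ▸ Set.mem_toFinset.1 hi)
    calc _ = ∑ k : Fin n, ψ (i * ((m : ℕ) : ZMod n)) *
          (charVec ψ i k * ψ (j * ((k : ℕ) : ZMod n))) :=
          Finset.sum_congr rfl fun k _ => by ring
      _ = 0 := by rw [← Finset.mul_sum, sum_charVec_mul hψ, if_neg hij, mul_zero]
  rw [charSpan, Submodule.span_le]
  rintro _ ⟨j, hj, rfl⟩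
  have hsum : ∑ m : Fin n, charVec ψ j m •
      (Algebra.linearMap F (AlgebraicClosure F)).compLeft (Fin n) (s m) =
        (n : AlgebraicClosure F) • charVec ψ j := by
    ext k
    simp only [Finset.sum_apply, Pi.smul_apply, LinearMap.compLeft_apply, Function.comp_apply,
      Algebra.linearMap_apply, smul_eq_mul, hs, Finset.mul_sum]
    rw [Finset.sum_comm]
    calc _ = ∑ i ∈ I.toFinset, charVec ψ i k *
          ∑ m : Fin n, charVec ψ j m * ψ (i * ((m : ℕ) : ZMod n)) := by
          refine Finset.sum_congr rfl fun i _ => ?_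
          rw [Finset.mul_sum]
          exact Finset.sum_congr rfl fun m _ => mul_left_comm _ _ _
      _ = _ := by simp [sum_charVec_mul hψ, hj, mul_comm]
  rw [SetLike.mem_coe, ← Submodule.smul_mem_iff _ hnK, ← hsum]
  exact Submodule.sum_mem _ fun m _ =>
    Submodule.smul_mem _ _ (Submodule.subset_span ⟨s m, hsI m, rfl⟩)

end CyclicCode

section UUV

variable {F : Type*} [Field F] {n : ℕ}

/-- The linear map `(u, v) ↦ (u, u + v)`. -/
def uuvMap (F : Type*) [Field F] (n : ℕ) :
    (Fin n → F) × (Fin n → F) →ₗ[F] (Fin 2 × Fin n → F) where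
  toFun p jk := ![p.1, p.1 + p.2] jk.1 jk.2
  map_add' p q := by
    ext ⟨j, k⟩
    fin_cases j <;> simp [add_add_add_comm]
  map_smul' r p := by
    ext ⟨j, k⟩
    fin_cases j <;> simp [mul_add]

@[simp] theorem uuvMap_apply_zero (p : (Fin n → F) × (Fin n → F)) (k : Fin n) :
    uuvMap F n p (0, k) = p.1 k := rfl

@[simp] theorem uuvMap_apply_one (p : (Fin n → F) × (Fin n → F)) (k : Fin n) :
    uuvMap F n p (1, k) = p.1 k + p.2 k := rfl

theorem uuvMap_injective : Function.Injective (uuvMap F n) := by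
  rintro ⟨a, b⟩ ⟨a', b'⟩ h
  have ha : a = a' := funext fun k => congrFun h (0, k)
  have hb : b = b' := funext fun k => by simpa [ha] using congrFun h (1, k)
  rw [ha, hb]

theorem uuvMap_mul (u v u' v' : Fin n → F) :
    uuvMap F n (u, v) * uuvMap F n (u', v') =
      uuvMap F n (u * u', v * (u' + v') + v' * u) := by
  ext ⟨j, k⟩
  fin_cases j
  · simp
  · simp; ring

theorem matrixProdCode_uuv (C₁ C₂ : Submodule F (Fin n → F)) :
    matrixProdCode ![C₁, C₂] !![(1 : F), 1; 0, 1] = (C₁.prod C₂).map (uuvMap F n) := by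
  ext x
  simp only [matrixProdCode, Submodule.mem_map]
  constructor
  · rintro ⟨c, hc, rfl⟩
    refine ⟨(c 0, c 1), ⟨hc 0 trivial, hc 1 trivial⟩, ?_⟩
    ext ⟨j, k⟩
    fin_cases j <;> simp [Fin.sum_univ_two]
  · rintro ⟨⟨u, v⟩, ⟨hu, hv⟩, rfl⟩
    refine ⟨![u, v], fun i _ => ?_, ?_⟩
    · fin_cases i
      exacts [hu, hv]
    · ext ⟨j, k⟩
      fin_cases j <;> simp [Fin.sum_univ_two]

theorem schurProd_map_uuvMap (C₁ C₂ : Submodule F (Fin n → F)) :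
    schurProd ((C₁.prod C₂).map (uuvMap F n)) ((C₁.prod C₂).map (uuvMap F n)) =
      ((schurProd C₁ C₁).prod (schurProd C₂ (C₁ ⊔ C₂))).map (uuvMap F n) := by
  apply le_antisymm
  · refine Submodule.span_le.2 ?_
    rintro _ ⟨_, ⟨⟨u, v⟩, ⟨hu, hv⟩, rfl⟩, _, ⟨⟨u', v'⟩, ⟨hu', hv'⟩, rfl⟩, rfl⟩
    rw [uuvMap_mul]
    refine Submodule.mem_map_of_mem ⟨Submodule.subset_span ⟨u, hu, u', hu', rfl⟩, ?_⟩
    exact Submodule.add_mem _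
      (Submodule.subset_span ⟨v, hv, u' + v', Submodule.add_mem_sup hu' hv', rfl⟩)
      (Submodule.subset_span ⟨v', hv', u, Submodule.mem_sup_left hu, rfl⟩)
  · rw [Submodule.map_le_iff_le_comap, Submodule.prod_le_iff, Submodule.map_le_iff_le_comap,
      Submodule.map_le_iff_le_comap]
    have hl {u : Fin n → F} (hu : u ∈ C₁) :
        uuvMap F n (u, 0) ∈ (C₁.prod C₂).map (uuvMap F n) :=
      Submodule.mem_map_of_mem ⟨hu, C₂.zero_mem⟩
    have hr {v : Fin n → F} (hv : v ∈ C₂) :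
        uuvMap F n (0, v) ∈ (C₁.prod C₂).map (uuvMap F n) :=
      Submodule.mem_map_of_mem ⟨C₁.zero_mem, hv⟩
    constructor <;> refine Submodule.span_le.2 ?_
    · rintro _ ⟨u, hu, u', hu', rfl⟩
      refine Submodule.subset_span ⟨_, hl hu, _, hl hu', ?_⟩
      rw [uuvMap_mul]
      simp
    · rintro _ ⟨v, hv, w, hw, rfl⟩
      obtain ⟨u, hu, v', hv', rfl⟩ := Submodule.mem_sup.1 hw
      have h : uuvMap F n (0, v * (u + v')) =
          uuvMap F n (0, v) * uuvMap F n (u, 0) + uuvMap F n (0, v) * uuvMap F n (0, v') := by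
        rw [uuvMap_mul, uuvMap_mul, ← map_add]
        simp [mul_add]
      change uuvMap F n (0, v * (u + v')) ∈ schurProd _ _
      rw [h]
      exact Submodule.add_mem _ (Submodule.subset_span ⟨_, hr hv, _, hl hu, rfl⟩)
        (Submodule.subset_span ⟨_, hr hv, _, hr hv', rfl⟩)

theorem finrank_map_uuvMap (D₁ D₂ : Submodule F (Fin n → F)) :
    Module.finrank F ((D₁.prod D₂).map (uuvMap F n)) =
      Module.finrank F D₁ + Module.finrank F D₂ := by
  have h : (D₁.prod D₂).map (uuvMap F n) =
      (uuvMap F n ∘ₗ D₁.subtype.prodMap D₂.subtype).range := by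
    rw [LinearMap.range_comp, LinearMap.range_prodMap, Submodule.range_subtype,
      Submodule.range_subtype]
  rw [h, LinearMap.finrank_range_of_inj, Module.finrank_prod]
  exact uuvMap_injective.comp (Subtype.val_injective.prodMap Subtype.val_injective)

theorem wt_uuvMap (a b : Fin n → F) : wt (uuvMap F n (a, b)) = wt a + wt (a + b) := by
  classical
  simp only [wt_eq_sum, Fintype.sum_prod_type, Fin.sum_univ_two, uuvMap_apply_zero,
    uuvMap_apply_one, Pi.add_apply]
  rfl

theorem wt_le_wt_add_wt_add (a b : Fin n → F) : wt b ≤ wt a + wt (a + b) := by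
  classical
  refine le_trans (Finset.card_le_card fun k hk => ?_) (Finset.card_union_le _ _)
  simp only [Finset.mem_filter, Finset.mem_univ, true_and, Finset.mem_union, Pi.add_apply] at hk ⊢
  by_contra! h
  exact hk (by simpa [h.1] using h.2)

theorem min_le_wt_uuvMap {D₁ D₂ : Submodule F (Fin n → F)} {d₁ d₂ : ℕ}
    (h₁ : ∀ a ∈ D₁, a ≠ 0 → d₁ ≤ wt a) (h₂ : ∀ b ∈ D₂, b ≠ 0 → d₂ ≤ wt b)
    {x : Fin 2 × Fin n → F} (hx : x ∈ (D₁.prod D₂).map (uuvMap F n)) (h0 : x ≠ 0) :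
    min (2 * d₁) d₂ ≤ wt x := by
  obtain ⟨⟨a, b⟩, ⟨ha, hb⟩, rfl⟩ := hx
  rw [wt_uuvMap]
  by_cases hb0 : b = 0
  · subst hb0
    have ha0 : a ≠ 0 := by
      rintro rfl
      exact h0 (map_zero _)
    have := h₁ a ha ha0
    rw [add_zero]
    omega
  · have := h₂ b hb hb0
    have := wt_le_wt_add_wt_add a b
    omega

theorem le_minDist {ι : Type*} [Fintype ι] {D : Submodule F (ι → F)} {d : ℕ} (hD : D ≠ ⊥)
    (h : ∀ x ∈ D, x ≠ 0 → d ≤ wt x) : d ≤ minDist (D : Set (ι → F)) := by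
  obtain ⟨x, hx, hx0⟩ := D.exists_mem_ne_zero_of_ne_bot hD
  refine le_csInf ⟨_, x, ⟨hx, hx0⟩, rfl⟩ ?_
  rintro _ ⟨y, ⟨hy, hy0⟩, rfl⟩
  exact h y hy hy0

end UUV

theorem wt_compLeft_algebraMap {F : Type*} (K : Type*) [Field F] [Field K] [Algebra F K]
    {ι : Type*} [Fintype ι] (x : ι → F) :
    wt ((Algebra.linearMap F K).compLeft ι x) = wt x := by
  classical
  simp [wt_eq_sum]

/-- For (nonempty) unions `I_1, I_2` of `q`-cyclotomic cosets modulo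
`n` (`gcd(n,q)=1`) and the `(u,u+v)`-construction `C = [C(I_1), C(I_2)]A`, one has
`dim C^{*2} = |I_1 + I_1| + |I_2 + (I_1 ∪ I_2)|` and
`d(C^{*2}) ≥ min{2(n - Amp(I_1+I_1) + 1), n - Amp(I_2 + (I_1 ∪ I_2)) + 1}`. -/
theorem uuv_cyclic_square_params
    {F : Type*} [Field F] [Fintype F] {n : ℕ} [NeZero n]
    (hn : Nat.Coprime n (Fintype.card F))
    (β : AlgebraicClosure F) (hβ : IsPrimitiveRoot β n)
    (I₁ I₂ : Set (ZMod n))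
    (hI₁ : ∀ a ∈ I₁, (Fintype.card F : ZMod n) * a ∈ I₁)
    (hI₂ : ∀ a ∈ I₂, (Fintype.card F : ZMod n) * a ∈ I₂)
    (h₁ : I₁.Nonempty) (h₂ : I₂.Nonempty) :
    Module.finrank F
        (schurProd
          (matrixProdCode ![cyclicCode F n β I₁, cyclicCode F n β I₂] !![(1 : F), 1; 0, 1])
          (matrixProdCode ![cyclicCode F n β I₁, cyclicCode F n β I₂] !![(1 : F), 1; 0, 1])) =
      (I₁ + I₁).ncard + (I₂ + (I₁ ∪ I₂)).ncard ∧
    min (2 * (n - amp (I₁ + I₁) + 1)) (n - amp (I₂ + (I₁ ∪ I₂)) + 1) ≤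
      minDist (schurProd
          (matrixProdCode ![cyclicCode F n β I₁, cyclicCode F n β I₂] !![(1 : F), 1; 0, 1])
          (matrixProdCode ![cyclicCode F n β I₁, cyclicCode F n β I₂] !![(1 : F), 1; 0, 1]) :
        Set (Fin 2 × Fin n → F)) := by
  have hψ := AddChar.zmodChar_primitive_of_primitive_root n hβ
  have hnK : (n : AlgebraicClosure F) ≠ 0 := by
    obtain ⟨m, hp, hq⟩ := FiniteField.card F (ringChar F)
    have := Fact.mk hp
    have := charP_of_injective_algebraMap
      (algebraMap F (AlgebraicClosure F)).injective (ringChar F)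
    rw [Ne, CharP.cast_eq_zero_iff (AlgebraicClosure F) (ringChar F)]
    intro hdvd
    exact hp.one_lt.ne' (Nat.eq_one_of_dvd_coprimes hn hdvd (hq ▸ dvd_pow_self _ m.ne_zero))
  have e₁ := extendScalars_cyclicCode hn hβ hnK hI₁
  have e₂ := extendScalars_cyclicCode hn hβ hnK hI₂
  set ψ := AddChar.zmodChar n hβ.pow_eq_one
  set C₁ := cyclicCode F n β I₁
  set C₂ := cyclicCode F n β I₂
  have eD₁ : extendScalars (AlgebraicClosure F) (schurProd C₁ C₁) = charSpan ψ (I₁ + I₁) := by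
    rw [extendScalars_schurProd, e₁, charSpan_mul]
  have eD₂ : extendScalars (AlgebraicClosure F) (schurProd C₂ (C₁ ⊔ C₂)) =
      charSpan ψ (I₂ + (I₁ ∪ I₂)) := by
    rw [extendScalars_schurProd, extendScalars_sup, e₁, e₂, charSpan_sup, charSpan_mul]
  have hdist {D : Submodule F (Fin n → F)} {J : Set (ZMod n)}
      (hD : extendScalars (AlgebraicClosure F) D = charSpan ψ J) :
      ∀ a ∈ D, a ≠ 0 → n - amp J + 1 ≤ wt a := by
    intro a ha ha0
    rw [← wt_compLeft_algebraMap (AlgebraicClosure F)]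
    refine le_wt_of_mem_charSpan hψ (hD ▸ Submodule.subset_span ⟨a, ha, rfl⟩) fun h => ha0 ?_
    ext k
    simpa using congrFun h k
  rw [matrixProdCode_uuv, schurProd_map_uuvMap]
  have hdim : Module.finrank F
      (((schurProd C₁ C₁).prod (schurProd C₂ (C₁ ⊔ C₂))).map (uuvMap F n)) =
        (I₁ + I₁).ncard + (I₂ + (I₁ ∪ I₂)).ncard := by
    rw [finrank_map_uuvMap, ← finrank_extendScalars (AlgebraicClosure F),
      ← finrank_extendScalars (AlgebraicClosure F) (schurProd C₂ _), eD₁, eD₂,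
      finrank_charSpan hψ hnK, finrank_charSpan hψ hnK]
  refine ⟨hdim, le_minDist ?_ fun x hx hx0 =>
    min_le_wt_uuvMap (hdist eD₁) (hdist eD₂) hx hx0⟩
  intro hbot
  rw [hbot, finrank_bot] at hdim
  have := (Set.ncard_pos (Set.toFinite _)).2 (h₁.add h₁)
  omega
end
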